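/- arXiv:math/0701738 — 2 statements merged into one kernel-verified Lean document; each statement's English description precedes it below -/
import Mathlib

section
/- Let c > 0 and let d : Γ → ℝ satisfy the growth condition with constant c, with d(γ) ≠ 0 for all γ, and suppose that for every R > 0 the set {γ ∈ Γ : |d(γ)| ≤ R} is finite. Write Γ⁺ = {γ ∈ Γ : d(γ) > 0} and Γ⁻ = Γ \ Γ⁺. Then there exist natural numbers M₁, …, M_{ℓ+1} such that: (a) the set A₁ = {γ : γ(ℓ+1) > M_{ℓ+1}} is contained in Γ⁺ or contained in Γ⁻; (b) the set A₂ = {γ : γ(ℓ+1) < −M_{ℓ+1}} is contained in Γ⁺ or contained in Γ⁻; and (c) for every k with 1 ≤ k ≤ ℓ and every tuple (i_{k+1},…,i_{ℓ+1}) with 0 ≤ i_r ≤ M_r for k+1 ≤ r ≤ ℓ and |i_{ℓ+1}| ≤ M_{ℓ+1}, the set B = {γ : γ(k) > M_k and γ(r) = i_r for all k+1 ≤ r ≤ ℓ+1} is contained in Γ⁺ or contained in Γ⁻. -/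
open scoped BigOperators InnerProductSpace

noncomputable section

/-- The index set `Γ = ℕ^ℓ × ℤ`. -/
abbrev Gamma (ℓ : ℕ) : Type := (Fin ℓ → ℕ) × ℤ

/-- The Hilbert space `H = ℓ²(Γ)`. -/
abbrev Hsp (ℓ : ℕ) := lp (fun _ : Gamma ℓ => ℂ) 2

/-- The standard orthonormal basis vector `e_γ`. -/
def e (ℓ : ℕ) (γ : Gamma ℓ) : Hsp ℓ := lp.single 2 γ 1

/-- `ε_k ∈ Γ`: the element whose `k`-th coordinate is `1` and all other coordinates are `0`
(`k` is zero-indexed: `k : Fin (ℓ+1)` corresponds to the coordinate `k+1` of the paper). -/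
def eps (ℓ : ℕ) (k : Fin (ℓ+1)) : Gamma ℓ :=
  if h : (k : ℕ) < ℓ then (Pi.single ⟨(k : ℕ), h⟩ 1, 0) else (0, 1)

/-- The `k`-th coordinate of `γ ∈ Γ`, viewed in `ℤ` (zero-indexed). -/
def coord {ℓ : ℕ} (γ : Gamma ℓ) (k : Fin (ℓ+1)) : ℤ :=
  if h : (k : ℕ) < ℓ then (γ.1 ⟨(k : ℕ), h⟩ : ℤ) else γ.2

/-- `γ(1) + … + γ(k−1)` (sum of the coordinates strictly before position `k`). -/
def sumBelow {ℓ : ℕ} (k : Fin (ℓ+1)) (γ : Gamma ℓ) : ℕ :=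
  ∑ j ∈ Finset.univ.filter (fun j : Fin ℓ => (j : ℕ) < (k : ℕ)), γ.1 j

/-- The growth condition `|d(γ+ε_k) − d(γ)| ≤ c·q^{−(γ(1)+…+γ(k−1))}` for all `γ` and `k`. -/
def GrowthCondition (ℓ : ℕ) (q c : ℝ) (d : Gamma ℓ → ℝ) : Prop :=
  ∀ (k : Fin (ℓ+1)) (γ : Gamma ℓ),
    |d (γ + eps ℓ k) - d γ| ≤ c * (q ^ sumBelow k γ)⁻¹

/-- The element of `Γ` obtained from `γ` by setting its first `j` coordinates to zero. -/
def clearBelow {ℓ : ℕ} (j : ℕ) (γ : Gamma ℓ) : Gamma ℓ :=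
  (fun i => if (i : ℕ) < j then 0 else γ.1 i, γ.2)

lemma sumBelow_eq_zero {ℓ : ℕ} {k : Fin (ℓ+1)} {γ : Gamma ℓ}
    (h : ∀ i : Fin ℓ, (i : ℕ) < (k : ℕ) → γ.1 i = 0) : sumBelow k γ = 0 :=
  Finset.sum_eq_zero fun i hi => h i (Finset.mem_filter.1 hi).2

lemma GrowthCondition.pos_add_eps_iff {ℓ : ℕ} {q c : ℝ} {d : Gamma ℓ → ℝ}
    (hd : GrowthCondition ℓ q c d) (k : Fin (ℓ+1)) (γ : Gamma ℓ)
    (h : ∀ i : Fin ℓ, (i : ℕ) < (k : ℕ) → γ.1 i = 0) (hγ : c < |d γ|) :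
    0 < d (γ + eps ℓ k) ↔ 0 < d γ := by
  have hs := hd k γ
  rw [sumBelow_eq_zero h, pow_zero, inv_one, mul_one, abs_le] at hs
  rcases lt_abs.1 hγ with h1 | h1 <;> constructor <;> intro h2 <;> linarith

lemma GrowthCondition.pos_update_iff {ℓ : ℕ} {q c : ℝ} {d : Gamma ℓ → ℝ}
    (hd : GrowthCondition ℓ q c d) (k : Fin ℓ) (γ : Gamma ℓ)
    (h : ∀ i : Fin ℓ, (i : ℕ) < (k : ℕ) → γ.1 i = 0) {m n : ℕ} (hmn : m ≤ n)
    (hbig : ∀ t, m ≤ t → t ≤ n → c < |d (Function.update γ.1 k t, γ.2)|) :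
    0 < d (Function.update γ.1 k n, γ.2) ↔ 0 < d (Function.update γ.1 k m, γ.2) := by
  induction n, hmn using Nat.le_induction with
  | base => rfl
  | succ n hmn ih =>
    rw [← ih fun t h1 h2 => hbig t h1 (h2.trans n.le_succ)]
    have hstep := hd.pos_add_eps_iff k.castSucc (Function.update γ.1 k n, γ.2)
      (fun i hi => by
        have hik : i ≠ k := by rintro rfl; simp at hi
        simpa [hik] using h i hi) (hbig n hmn n.le_succ)
    rw [← hstep]
    have heq : ((Function.update γ.1 k n, γ.2) : Gamma ℓ) + eps ℓ k.castSucc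
        = (Function.update γ.1 k (n + 1), γ.2) := by
      ext i
      · by_cases hik : i = k
        · subst hik; simp [eps]
        · simp [eps, hik]
      · simp [eps]
    rw [heq]

lemma GrowthCondition.pos_snd_iff {ℓ : ℕ} {q c : ℝ} {d : Gamma ℓ → ℝ}
    (hd : GrowthCondition ℓ q c d) {m n : ℤ} (hmn : m ≤ n)
    (hbig : ∀ t, m ≤ t → t ≤ n → c < |d (0, t)|) :
    0 < d (0, n) ↔ 0 < d (0, m) := by
  induction n, hmn using Int.leInduction with
  | base => rfl
  | succ n hmn ih =>
    rw [← ih fun t h1 h2 => hbig t h1 (by omega),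
      ← hd.pos_add_eps_iff (Fin.last ℓ) (0, n) (fun i _ => rfl) (hbig n hmn (by omega))]
    simp [eps]

lemma GrowthCondition.pos_clearBelow_iff {ℓ : ℕ} {q c : ℝ} {d : Gamma ℓ → ℝ}
    (hd : GrowthCondition ℓ q c d) (γ : Gamma ℓ) {j : ℕ} (hj : j ≤ ℓ)
    (hbig : ∀ δ : Gamma ℓ, (∀ i : Fin ℓ, j ≤ (i : ℕ) → δ.1 i = γ.1 i) → δ.2 = γ.2 → c < |d δ|) :
    0 < d (clearBelow j γ) ↔ 0 < d γ := by
  induction j with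
  | zero => simp [clearBelow]
  | succ j ih =>
    rw [← ih (by omega) fun δ h1 h2 => hbig δ (fun i hi => h1 i (by omega)) h2]
    have hstep := hd.pos_update_iff ⟨j, hj⟩ (clearBelow j γ)
      (fun i hi => if_pos hi) (Nat.zero_le (γ.1 ⟨j, hj⟩))
      (fun t _ _ => hbig _ (fun i hi => by
        have hij : i ≠ ⟨j, hj⟩ := by rintro rfl; simp at hi
        have hlt : ¬ (i : ℕ) < j := by omega
        simp [hij, clearBelow, hlt]) rfl)
    have h1 : ((Function.update (clearBelow j γ).1 ⟨j, hj⟩ (γ.1 ⟨j, hj⟩), (clearBelow j γ).2)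
        : Gamma ℓ) = clearBelow j γ := by
      ext i
      · by_cases hij : i = ⟨j, hj⟩
        · subst hij; simp [clearBelow]
        · simp [hij]
      · rfl
    have h2 : ((Function.update (clearBelow j γ).1 ⟨j, hj⟩ 0, (clearBelow j γ).2)
        : Gamma ℓ) = clearBelow (j + 1) γ := by
      ext i
      · by_cases hij : i = ⟨j, hj⟩
        · subst hij; simp [clearBelow]
        · have hne : (i : ℕ) ≠ j := fun h => hij (Fin.ext h)
          have hiff : (i : ℕ) < j ↔ (i : ℕ) < j + 1 := by omega
          simp [hij, clearBelow, hiff]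
      · rfl
    rw [h1, h2] at hstep
    exact hstep.symm

lemma Gamma.exists_bound_of_finite {ℓ : ℕ} {F : Set (Gamma ℓ)} (hF : F.Finite) :
    ∃ N : ℕ, ∀ γ ∈ F, (∀ i, γ.1 i ≤ N) ∧ |γ.2| ≤ N := by
  refine ⟨hF.toFinset.sup fun γ => Finset.univ.sup γ.1 ⊔ γ.2.natAbs, fun γ hγ => ?_⟩
  have h := Finset.le_sup (f := fun γ : Gamma ℓ => Finset.univ.sup γ.1 ⊔ γ.2.natAbs)
    (hF.mem_toFinset.2 hγ)
  rw [sup_le_iff] at h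
  refine ⟨fun i => (Finset.le_sup (Finset.mem_univ i)).trans h.1, ?_⟩
  rw [Int.abs_eq_natAbs]
  exact_mod_cast h.2

lemma Set.subset_or_subset_compl_of_iff {α : Type*} {s t : Set α} {P : Prop}
    (h : ∀ x ∈ s, x ∈ t ↔ P) : s ⊆ t ∨ s ⊆ tᶜ := by
  by_cases hP : P
  · exact Or.inl fun x hx => (h x hx).2 hP
  · exact Or.inr fun x hx hxt => hP ((h x hx).1 hxt)

/-- sign characterization.  If `d` satisfies the growth condition, never
vanishes, and has finite level sets (compact resolvent), then there are
`M₁, …, M_{ℓ+1} ∈ ℕ` such that each of the sets `A₁`, `A₂` and `B_{k,(i_{k+1},…,i_{ℓ+1})}`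
is contained either in `Γ⁺ = {d > 0}` or in its complement `Γ⁻`. -/
theorem stmt5 (ℓ : ℕ) (hℓ : 1 ≤ ℓ) (q c : ℝ) (hq : 0 < q) (hq1 : q < 1) (hc : 0 < c)
    (d : Gamma ℓ → ℝ) (hd : GrowthCondition ℓ q c d)
    (hne : ∀ γ : Gamma ℓ, d γ ≠ 0)
    (hfin : ∀ R : ℝ, 0 < R → {γ : Gamma ℓ | |d γ| ≤ R}.Finite) :
    ∃ M : Fin (ℓ+1) → ℕ,
      ({γ : Gamma ℓ | (M (Fin.last ℓ) : ℤ) < γ.2} ⊆ {γ : Gamma ℓ | 0 < d γ} ∨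
        {γ : Gamma ℓ | (M (Fin.last ℓ) : ℤ) < γ.2} ⊆ {γ : Gamma ℓ | 0 < d γ}ᶜ) ∧
      ({γ : Gamma ℓ | γ.2 < -(M (Fin.last ℓ) : ℤ)} ⊆ {γ : Gamma ℓ | 0 < d γ} ∨
        {γ : Gamma ℓ | γ.2 < -(M (Fin.last ℓ) : ℤ)} ⊆ {γ : Gamma ℓ | 0 < d γ}ᶜ) ∧
      (∀ (k : Fin ℓ) (x : Fin (ℓ+1) → ℤ),
        (∀ r : Fin ℓ, (k : ℕ) < (r : ℕ) →
          0 ≤ x r.castSucc ∧ x r.castSucc ≤ (M r.castSucc : ℤ)) →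
        |x (Fin.last ℓ)| ≤ (M (Fin.last ℓ) : ℤ) →
        ({γ : Gamma ℓ | (M k.castSucc : ℤ) < (γ.1 k : ℤ) ∧
            ∀ r : Fin (ℓ+1), (k : ℕ) < (r : ℕ) → coord γ r = x r}
            ⊆ {γ : Gamma ℓ | 0 < d γ} ∨
         {γ : Gamma ℓ | (M k.castSucc : ℤ) < (γ.1 k : ℤ) ∧
            ∀ r : Fin (ℓ+1), (k : ℕ) < (r : ℕ) → coord γ r = x r}
            ⊆ {γ : Gamma ℓ | 0 < d γ}ᶜ)) := by
  obtain ⟨N, hN⟩ := Gamma.exists_bound_of_finite (hfin c hc)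
  have hbig₁ : ∀ (γ : Gamma ℓ) (i : Fin ℓ), N < γ.1 i → c < |d γ| := fun γ i hi =>
    not_le.1 fun h => absurd ((hN γ h).1 i) (not_le.2 hi)
  have hbig₂ : ∀ γ : Gamma ℓ, (N : ℤ) < |γ.2| → c < |d γ| := fun γ hγ =>
    not_le.1 fun h => absurd (hN γ h).2 (not_le.2 hγ)
  have hclear : ∀ γ : Gamma ℓ, (N : ℤ) < |γ.2| → (0 < d γ ↔ 0 < d (0, γ.2)) := by
    intro γ hγ
    rw [← hd.pos_clearBelow_iff γ le_rfl fun δ _ h => hbig₂ δ (by rwa [h])]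
    have heq : clearBelow ℓ γ = (0, γ.2) := by
      ext i <;> simp [clearBelow]
    rw [heq]
  refine ⟨fun _ => N, ?_, ?_, ?_⟩
  · refine Set.subset_or_subset_compl_of_iff (P := 0 < d (0, (N : ℤ) + 1)) fun γ hγ => ?_
    have hγ' : (N : ℤ) < γ.2 := hγ
    exact (hclear γ (lt_abs.2 (Or.inl hγ'))).trans
      (hd.pos_snd_iff hγ' fun t ht _ => hbig₂ (0, t) (lt_abs.2 (Or.inl ht)))
  · refine Set.subset_or_subset_compl_of_iff (P := 0 < d (0, -(N : ℤ) - 1)) fun γ hγ => ?_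
    have hγ' : γ.2 < -(N : ℤ) := hγ
    exact (hclear γ (lt_abs.2 (Or.inr (by omega)))).trans
      (hd.pos_snd_iff (by omega) fun t _ ht =>
        hbig₂ (0, t) (lt_abs.2 (Or.inr (by dsimp only; omega)))).symm
  · intro k x _ _
    refine Set.subset_or_subset_compl_of_iff
      (P := 0 < d (fun i : Fin ℓ => if (i : ℕ) < k then 0 else
        if i = k then N + 1 else (x i.castSucc).toNat, x (Fin.last ℓ))) ?_
    rintro γ ⟨hk, hx⟩
    have hk' : N < γ.1 k := by exact_mod_cast hk
    have hlast : γ.2 = x (Fin.last ℓ) := by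
      simpa [coord] using hx (Fin.last ℓ) k.isLt
    have hcoord : ∀ i : Fin ℓ, (k : ℕ) < i → γ.1 i = (x i.castSucc).toNat := by
      intro i hi
      have h := hx i.castSucc hi
      simp only [coord, Fin.val_castSucc, i.isLt, dite_true, Fin.eta] at h
      omega
    have hstep := hd.pos_update_iff k (clearBelow k γ) (fun i hi => if_pos hi)
      (Nat.succ_le_of_lt hk') (fun t ht _ => hbig₁ _ k (by simpa using ht))
    have h1 : ((Function.update (clearBelow k γ).1 k (γ.1 k), (clearBelow k γ).2)
        : Gamma ℓ) = clearBelow k γ := by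
      ext i
      · by_cases hik : i = k
        · subst hik; simp [clearBelow]
        · simp [hik]
      · rfl
    have h2 : ((Function.update (clearBelow k γ).1 k N.succ, (clearBelow k γ).2) : Gamma ℓ)
        = (fun i : Fin ℓ => if (i : ℕ) < k then 0 else
            if i = k then N + 1 else (x i.castSucc).toNat, x (Fin.last ℓ)) := by
      ext i
      · by_cases hik : i = k
        · subst hik; simp
        · by_cases hlt : (i : ℕ) < k
          · simp only [ne_eq, hik, not_false_eq_true, Function.update_of_ne, clearBelow, hlt,
              if_true]
          · have hne : (i : ℕ) ≠ k := fun h => hik (Fin.ext h)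
            simp only [ne_eq, hik, not_false_eq_true, Function.update_of_ne, clearBelow, hlt,
              if_false]
            exact hcoord i (by omega)
      · exact hlast
    rw [h1, h2] at hstep
    exact (hd.pos_clearBelow_iff γ k.isLt.le fun δ h _ =>
      hbig₁ δ k (by rwa [h k le_rfl])).symm.trans hstep
end
end

section
/- Let P be the orthogonal projection of H onto the closed linear span of {e_γ : γ(ℓ+1) ≥ 0} (this is ½(sign D_torus + 1) for the operator D_torus), and let U be the unitary with U e_γ = e_{γ+ε_{ℓ+1}} if γ(1)=…=γ(ℓ)=0 and U e_γ = e_γ otherwise. Then the compression T : ran P → ran P, T x = P(U x), is injective, has closed range, and the orthogonal complement of its range inside ran P is the one-dimensional span of e_0, where 0 denotes the element of Γ with all coordinates 0. In particular T is Fredholm of index −1. -/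
open scoped BigOperators InnerProductSpace

noncomputable section

/-- A continuous functional on `ℓ²(Γ)` is determined by its values on the basis vectors. -/
theorem functional_ext {ℓ : ℕ} {f g : Hsp ℓ →L[ℂ] ℂ} (h : ∀ γ, f (e ℓ γ) = g (e ℓ γ)) :
    f = g := by
  refine lp.ext_continuousLinearMap (by norm_num) fun γ => ?_
  ext
  simpa [e] using h γ

/-- The `δ`-th coordinate of a vector, as a continuous functional. -/
def coordFunctional (ℓ : ℕ) (δ : Gamma ℓ) : Hsp ℓ →L[ℂ] ℂ :=
  lp.evalCLM ℂ (fun _ : Gamma ℓ => ℂ) 2 δ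

theorem coordFunctional_apply {ℓ : ℕ} (δ : Gamma ℓ) (x : Hsp ℓ) :
    coordFunctional ℓ δ x = x δ := rfl

theorem e_apply {ℓ : ℕ} (γ δ : Gamma ℓ) : e ℓ γ δ = if δ = γ then 1 else 0 := by
  simp [e, Pi.single_apply]

theorem inner_e_left {ℓ : ℕ} (γ : Gamma ℓ) (y : Hsp ℓ) : ⟪e ℓ γ, y⟫_ℂ = y γ := by
  rw [e, lp.inner_single_left]
  simp

/-- The permutation of `Γ` shifting the last coordinate on the axis `γ(1) = … = γ(ℓ) = 0`. -/
def axisShift (ℓ : ℕ) : Equiv.Perm (Gamma ℓ) where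
  toFun γ := if γ.1 = 0 then (γ.1, γ.2 + 1) else γ
  invFun γ := if γ.1 = 0 then (γ.1, γ.2 - 1) else γ
  left_inv γ := by
    by_cases h : γ.1 = 0 <;> simp [h, Prod.ext_iff]
  right_inv γ := by
    by_cases h : γ.1 = 0 <;> simp [h, Prod.ext_iff]

theorem axisShift_apply {ℓ : ℕ} (γ : Gamma ℓ) :
    axisShift ℓ γ = if γ.1 = 0 then (γ.1, γ.2 + 1) else γ := rfl

theorem axisShift_symm_apply {ℓ : ℕ} (γ : Gamma ℓ) :
    (axisShift ℓ).symm γ = if γ.1 = 0 then (γ.1, γ.2 - 1) else γ := rfl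

theorem apply_of_map_e_perm {ℓ : ℕ} {U : Hsp ℓ →L[ℂ] Hsp ℓ} {σ : Equiv.Perm (Gamma ℓ)}
    (hU : ∀ γ, U (e ℓ γ) = e ℓ (σ γ)) (x : Hsp ℓ) (δ : Gamma ℓ) : U x δ = x (σ.symm δ) := by
  have h : (coordFunctional ℓ δ).comp U = coordFunctional ℓ (σ.symm δ) := by
    refine functional_ext fun γ => ?_
    simp only [ContinuousLinearMap.comp_apply, coordFunctional_apply, hU, e_apply,
      Equiv.symm_apply_eq]
  exact DFunLike.congr_fun h x

theorem apply_of_map_e_ite {ℓ : ℕ} {P : Hsp ℓ →L[ℂ] Hsp ℓ}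
    (hP1 : ∀ γ : Gamma ℓ, 0 ≤ γ.2 → P (e ℓ γ) = e ℓ γ)
    (hP2 : ∀ γ : Gamma ℓ, γ.2 < 0 → P (e ℓ γ) = 0) (x : Hsp ℓ) (δ : Gamma ℓ) :
    P x δ = if 0 ≤ δ.2 then x δ else 0 := by
  have h : (coordFunctional ℓ δ).comp P = if 0 ≤ δ.2 then coordFunctional ℓ δ else 0 := by
    refine functional_ext fun γ => ?_
    by_cases hγ : 0 ≤ γ.2
    · by_cases hδ : 0 ≤ δ.2
      · simp [hδ, hP1 γ hγ]
      · have : δ ≠ γ := by rintro rfl; exact hδ hγ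
        simp [hδ, hP1 γ hγ, coordFunctional_apply, e_apply, this]
    · by_cases hδ : 0 ≤ δ.2
      · have : δ ≠ γ := by rintro rfl; exact hγ hδ
        simp [hδ, hP2 γ (not_le.mp hγ), coordFunctional_apply, e_apply, this]
      · simp [hδ, hP2 γ (not_le.mp hγ)]
  have := DFunLike.congr_fun h x
  by_cases hδ : 0 ≤ δ.2
  · simpa [hδ, coordFunctional_apply] using this
  · simpa [hδ, coordFunctional_apply] using this

theorem exists_coord_comp {ℓ : ℕ} (σ : Equiv.Perm (Gamma ℓ)) (y : Hsp ℓ) :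
    ∃ x : Hsp ℓ, ∀ γ, x γ = y (σ γ) := by
  have hy := (memℓp_gen_iff (by norm_num)).mp (lp.memℓp y)
  exact ⟨⟨fun γ => y (σ γ), memℓp_gen (hy.comp_injective σ.injective)⟩, fun _ => rfl⟩

/-- the compression `T = PUP` of the unitary `U` to the range of the
projection `P = ½(sign D_torus + 1)` (onto the closed span of `{e_γ : γ(ℓ+1) ≥ 0}`) is
injective, has closed range, and the orthogonal complement of its range inside `ran P`
is the span of `e_0`; in particular `T` is Fredholm of index `−1`. -/
theorem stmt9 (ℓ : ℕ) (hℓ : 1 ≤ ℓ)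
    (U P : Hsp ℓ →L[ℂ] Hsp ℓ)
    (hU1 : ∀ γ : Gamma ℓ, γ.1 = 0 → U (e ℓ γ) = e ℓ (γ + eps ℓ (Fin.last ℓ)))
    (hU2 : ∀ γ : Gamma ℓ, γ.1 ≠ 0 → U (e ℓ γ) = e ℓ γ)
    (hP1 : ∀ γ : Gamma ℓ, 0 ≤ γ.2 → P (e ℓ γ) = e ℓ γ)
    (hP2 : ∀ γ : Gamma ℓ, γ.2 < 0 → P (e ℓ γ) = 0) :
    (∀ x : Hsp ℓ, P x = x → P (U x) = 0 → x = 0) ∧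
    IsClosed {y : Hsp ℓ | ∃ x : Hsp ℓ, P x = x ∧ y = P (U x)} ∧
    (∀ y : Hsp ℓ, P y = y →
      ((∀ x : Hsp ℓ, P x = x → ⟪P (U x), y⟫_ℂ = 0) ↔ ∃ c : ℂ, y = c • e ℓ 0)) := by
  have hU : ∀ γ, U (e ℓ γ) = e ℓ (axisShift ℓ γ) := by
    intro γ
    rw [axisShift_apply]
    split_ifs with h
    · rw [hU1 γ h]
      simp [eps, Prod.add_def]
    · exact hU2 γ h
  have Ux := apply_of_map_e_perm hU
  have Px := apply_of_map_e_ite hP1 hP2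
  have P_iff : ∀ x : Hsp ℓ, P x = x ↔ ∀ γ : Gamma ℓ, γ.2 < 0 → x γ = 0 := by
    intro x
    constructor
    · intro h γ hγ
      rw [← h, Px, if_neg (not_le.mpr hγ)]
    · intro h
      ext γ
      rw [Px]
      split_ifs with hγ
      · rfl
      · exact (h γ (not_le.mp hγ)).symm
  have PU : ∀ x : Hsp ℓ, P x = x → P (U x) = U x := by
    intro x hx
    rw [P_iff] at hx ⊢
    intro γ hγ
    rw [Ux, axisShift_symm_apply]
    apply hx
    split_ifs <;> grind
  have PUx_zero : ∀ x : Hsp ℓ, P x = x → P (U x) 0 = 0 := by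
    intro x hx
    rw [PU x hx, Ux]
    exact (P_iff x).mp hx _ (by simp [axisShift_symm_apply])
  have range_eq : {y : Hsp ℓ | ∃ x : Hsp ℓ, P x = x ∧ y = P (U x)} =
      {y | P y = y} ∩ {y | coordFunctional ℓ 0 y = 0} := by
    ext y
    constructor
    · rintro ⟨x, hx, rfl⟩
      exact ⟨show P (P (U x)) = P (U x) by simp only [PU x hx], PUx_zero x hx⟩
    · rintro ⟨hy, hy0⟩
      obtain ⟨x, hxy⟩ := exists_coord_comp (axisShift ℓ) y
      have hx : P x = x := by
        rw [P_iff]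
        intro γ hγ
        rw [hxy, axisShift_apply]
        by_cases h : γ.1 = 0
        · rw [if_pos h]
          rcases (Int.add_one_le_iff.mpr hγ).lt_or_eq with h1 | h1
          · exact (P_iff y).mp hy _ h1
          · rw [h, h1]
            exact hy0
        · rw [if_neg h]
          exact (P_iff y).mp hy _ hγ
      refine ⟨x, hx, ?_⟩
      rw [PU x hx]
      ext γ
      rw [Ux, hxy, Equiv.apply_symm_apply]
  refine ⟨?_, ?_, ?_⟩
  · intro x hx h
    rw [PU x hx] at h
    ext γ
    have := Ux x (axisShift ℓ γ)
    rw [h, Equiv.symm_apply_apply] at this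
    exact this.symm
  · rw [range_eq]
    exact (isClosed_eq P.continuous continuous_id).inter
      (isClosed_eq (coordFunctional ℓ 0).continuous continuous_const)
  · intro y hy
    constructor
    · intro h
      refine ⟨y 0, ?_⟩
      ext δ
      rw [lp.coeFn_smul, Pi.smul_apply, e_apply]
      split_ifs with hδ
      · simp [hδ]
      · rw [smul_zero]
        by_cases hδ2 : δ.2 < 0
        · exact (P_iff y).mp hy δ hδ2
        · have hpre : 0 ≤ ((axisShift ℓ).symm δ).2 := by
            rw [axisShift_symm_apply]
            split_ifs with h1
            · have : δ.2 ≠ 0 := fun h2 => hδ (Prod.ext h1 h2)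
              simp only
              omega
            · omega
          have hx := hP1 _ hpre
          have := h _ hx
          rwa [PU _ hx, hU, Equiv.apply_symm_apply, inner_e_left] at this
    · rintro ⟨c, rfl⟩ x hx
      rw [inner_smul_right, ← inner_conj_symm, inner_e_left, PUx_zero x hx]
      simp
end
end
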